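/- For every N ∈ ℕ, the family Θ̄_N is an (8/√N + 4/N, d_EM)-covering of Θ̄: for every binary-signal conditionally independent information structure θ ∈ Θ̄, there exists θ' ∈ Θ̄_N such that d_EM(P_θ, P_{θ'}) ≤ 8/√N + 4/N. -/

import Mathlib

open Finset

/-- An information structure with a binary state `ω : Bool` (prior `μ = P(ω = 1)`) and two
signals `s1 : S1`, `s2 : S2` that are conditionally independent given the state,
encoded by the joint mass function `P`. -/
structure InfoStruct (S1 S2 : Type) [Fintype S1] [Fintype S2] : Type where
  P : Bool → S1 → S2 → ℝ
  nonneg : ∀ ω s1 s2, 0 ≤ P ω s1 s2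
  sum_one : ∑ ω : Bool, ∑ s1 : S1, ∑ s2 : S2, P ω s1 s2 = 1
  condIndep : ∀ ω s1 s2,
    (∑ t1 : S1, ∑ t2 : S2, P ω t1 t2) * P ω s1 s2 =
      (∑ t2 : S2, P ω s1 t2) * (∑ t1 : S1, P ω t1 s2)

namespace InfoStruct

variable {S1 S2 : Type} [Fintype S1] [Fintype S2]

/-- The prior `μ = P(ω = 1)`. -/
def prior (θ : InfoStruct S1 S2) : ℝ := ∑ s1 : S1, ∑ s2 : S2, θ.P true s1 s2

/-- The marginal probability of a signal pair `(s1, s2)`. -/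
def pSig (θ : InfoStruct S1 S2) (s1 : S1) (s2 : S2) : ℝ := ∑ ω : Bool, θ.P ω s1 s2

/-- The marginal probability of agent 1's signal. -/
def p1 (θ : InfoStruct S1 S2) (s1 : S1) : ℝ := ∑ ω : Bool, ∑ s2 : S2, θ.P ω s1 s2

/-- The marginal probability of agent 2's signal. -/
def p2 (θ : InfoStruct S1 S2) (s2 : S2) : ℝ := ∑ ω : Bool, ∑ s1 : S1, θ.P ω s1 s2

/-- Agent 1's report `x1 = P(ω = 1 | s1)`. -/
noncomputable def x1 (θ : InfoStruct S1 S2) (s1 : S1) : ℝ :=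
  (∑ s2 : S2, θ.P true s1 s2) / θ.p1 s1

/-- Agent 2's report `x2 = P(ω = 1 | s2)`. -/
noncomputable def x2 (θ : InfoStruct S1 S2) (s2 : S2) : ℝ :=
  (∑ s1 : S1, θ.P true s1 s2) / θ.p2 s2

/-- The posterior `P(ω = 1 | s1, s2)`. -/
noncomputable def post (θ : InfoStruct S1 S2) (s1 : S1) (s2 : S2) : ℝ :=
  θ.P true s1 s2 / θ.pSig s1 s2

/-- Expectation of a function of the report pair `(x1, x2)` under `θ`. -/
noncomputable def expect (θ : InfoStruct S1 S2) (h : ℝ → ℝ → ℝ) : ℝ :=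
  ∑ s1 : S1, ∑ s2 : S2, θ.pSig s1 s2 * h (θ.x1 s1) (θ.x2 s2)

/-- Probability that the report pair `(x1, x2)` lies in a set `A ⊆ ℝ²`. -/
noncomputable def probR (θ : InfoStruct S1 S2) (A : Set (ℝ × ℝ)) : ℝ :=
  ∑ s1 : S1, ∑ s2 : S2, A.indicator (fun _ => θ.pSig s1 s2) (θ.x1 s1, θ.x2 s2)

end InfoStruct

/-- Earth mover's (Wasserstein-1) distance, w.r.t. the ℓ1 metric, between the report
distributions of two information structures:
`d_EM(P,Q) = ⨆_{‖h‖_Lip ≤ 1} (E_P[h] - E_Q[h])`. -/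
noncomputable def dEM {S1 S2 T1 T2 : Type} [Fintype S1] [Fintype S2] [Fintype T1] [Fintype T2]
    (θ : InfoStruct S1 S2) (θ' : InfoStruct T1 T2) : ℝ :=
  sSup {r : ℝ | ∃ h : ℝ → ℝ → ℝ,
    (∀ a b a' b', |h a b - h a' b'| ≤ |a - a'| + |b - b'|) ∧
    r = θ.expect h - θ'.expect h}

/-- `r` lies in the discrete grid `[1/N] = {0, 1/N, 2/N, …, 1}`. -/
def inGrid (N : ℕ) (r : ℝ) : Prop := ∃ k : ℕ, k ≤ N ∧ r = (k : ℝ) / N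

/-- Membership in `Θ̄_N`: all reports of the binary-signal information structure lie in the
grid `[1/N]`. -/
def reportsInGrid (N : ℕ) (θ : InfoStruct Bool Bool) : Prop :=
  (∀ s1 : Bool, inGrid N (θ.x1 s1)) ∧ (∀ s2 : Bool, inGrid N (θ.x2 s2))

namespace InfoStruct

variable {S1 S2 T : Type} [Fintype S1] [Fintype S2] [Fintype T]

/-- Exchange the roles of the two agents. -/
def swap (θ : InfoStruct S1 S2) : InfoStruct S2 S1 where
  P ω s2 s1 := θ.P ω s1 s2
  nonneg ω s2 s1 := θ.nonneg ω s1 s2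
  sum_one := by
    rw [← θ.sum_one]
    exact sum_congr rfl fun ω _ => sum_comm
  condIndep ω s2 s1 := by
    rw [sum_comm, θ.condIndep ω s1 s2, mul_comm]

theorem expect_swap (θ : InfoStruct S1 S2) (h : ℝ → ℝ → ℝ) :
    θ.swap.expect (fun a b => h b a) = θ.expect h := sum_comm

/-- Replace agent 1's signal by the output of a stochastic kernel `R`, which may depend on the
state. -/
def mapSignal (θ : InfoStruct S1 S2) (R : Bool → S1 → T → ℝ) (hR : ∀ ω s t, 0 ≤ R ω s t)
    (hR1 : ∀ ω s, ∑ t, R ω s t = 1) : InfoStruct T S2 where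
  P ω t s2 := ∑ s, R ω s t * θ.P ω s s2
  nonneg ω t s2 := sum_nonneg fun s _ => mul_nonneg (hR ω s t) (θ.nonneg ω s s2)
  sum_one := by
    rw [← θ.sum_one]
    refine sum_congr rfl fun ω _ => ?_
    rw [sum_comm, sum_comm (s := (univ : Finset S1))]
    refine sum_congr rfl fun s2 _ => ?_
    rw [sum_comm]
    simp [← sum_mul, hR1]
  condIndep ω t s2 := by
    have hmarg (s2 : S2) : ∑ t, ∑ s, R ω s t * θ.P ω s s2 = ∑ s, θ.P ω s s2 := by
      rw [sum_comm]
      simp [← sum_mul, hR1]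
    have htotal : ∑ t, ∑ s2, ∑ s, R ω s t * θ.P ω s s2 = ∑ s, ∑ s2, θ.P ω s s2 := by
      rw [sum_comm, sum_comm (s := (univ : Finset S1))]
      exact sum_congr rfl fun s2 _ => hmarg s2
    rw [hmarg, htotal, sum_comm (s := (univ : Finset S2)), mul_sum, sum_mul]
    refine sum_congr rfl fun s _ => ?_
    rw [← mul_sum, mul_left_comm, θ.condIndep ω s s2, mul_assoc]

section mapSignal

variable (θ : InfoStruct S1 S2) (R : Bool → S1 → T → ℝ) (hR : ∀ ω s t, 0 ≤ R ω s t)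
  (hR1 : ∀ ω s, ∑ t, R ω s t = 1)

theorem sum_mapSignal_P (ω : Bool) (s2 : S2) :
    ∑ t, (θ.mapSignal R hR hR1).P ω t s2 = ∑ s, θ.P ω s s2 := by
  change ∑ t, ∑ s, R ω s t * θ.P ω s s2 = _
  rw [sum_comm]
  simp [← sum_mul, hR1]

theorem x2_mapSignal (s2 : S2) : (θ.mapSignal R hR hR1).x2 s2 = θ.x2 s2 := by
  simp only [x2, p2, sum_mapSignal_P]

theorem marginal_mapSignal (ω : Bool) (t : T) :
    ∑ s2, (θ.mapSignal R hR hR1).P ω t s2 = ∑ s, R ω s t * ∑ s2, θ.P ω s s2 := by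
  change ∑ s2, ∑ s, R ω s t * θ.P ω s s2 = _
  rw [sum_comm]
  simp [mul_sum]

theorem expect_sub_expect_mapSignal_le (h : ℝ → ℝ → ℝ)
    (hh : ∀ a b a' b', |h a b - h a' b'| ≤ |a - a'| + |b - b'|) :
    θ.expect h - (θ.mapSignal R hR hR1).expect h ≤
      ∑ s, ∑ t, (∑ ω, R ω s t * ∑ s2, θ.P ω s s2) *
        |θ.x1 s - (θ.mapSignal R hR hR1).x1 t| := by
  have h₁ : θ.expect h = ∑ s, ∑ t, ∑ ω, ∑ s2, R ω s t * θ.P ω s s2 * h (θ.x1 s) (θ.x2 s2) := by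
    refine sum_congr rfl fun s _ => ?_
    simp only [pSig, sum_mul]
    rw [sum_comm, sum_comm (s := (univ : Finset T))]
    refine sum_congr rfl fun ω _ => ?_
    rw [sum_comm]
    refine sum_congr rfl fun s2 _ => ?_
    simp only [mul_assoc]
    rw [← sum_mul, hR1, one_mul]
  have h₂ : (θ.mapSignal R hR hR1).expect h = ∑ s, ∑ t, ∑ ω, ∑ s2,
      R ω s t * θ.P ω s s2 * h ((θ.mapSignal R hR hR1).x1 t) (θ.x2 s2) := by
    rw [sum_comm]
    refine sum_congr rfl fun t _ => ?_
    simp only [pSig, x2_mapSignal, sum_mul]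
    rw [sum_comm, sum_comm (s := (univ : Finset S1))]
    refine sum_congr rfl fun ω _ => ?_
    rw [sum_comm (s := (univ : Finset S1))]
    refine sum_congr rfl fun s2 _ => ?_
    simp only [mapSignal, sum_mul]
  rw [h₁, h₂]
  simp only [← sum_sub_distrib, sum_mul, mul_sum]
  refine sum_le_sum fun s _ => sum_le_sum fun t _ => sum_le_sum fun ω _ =>
    sum_le_sum fun s2 _ => ?_
  rw [← mul_sub]
  refine mul_le_mul_of_nonneg_left ?_ (mul_nonneg (hR ω s t) (θ.nonneg ω s s2))
  simpa using (le_abs_self _).trans (hh (θ.x1 s) (θ.x2 s2) _ (θ.x2 s2))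

end mapSignal

theorem marginal_nonneg (θ : InfoStruct S1 S2) (ω : Bool) (s : S1) : 0 ≤ ∑ s2, θ.P ω s s2 :=
  sum_nonneg fun s2 _ => θ.nonneg ω s s2

theorem p1_eq (θ : InfoStruct S1 S2) (s : S1) :
    θ.p1 s = ∑ s2, θ.P true s s2 + ∑ s2, θ.P false s s2 := by
  simp [p1]

theorem p1_nonneg (θ : InfoStruct S1 S2) (s : S1) : 0 ≤ θ.p1 s :=
  sum_nonneg fun ω _ => θ.marginal_nonneg ω s

theorem sum_p1 (θ : InfoStruct S1 S2) : ∑ s, θ.p1 s = 1 := by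
  rw [← θ.sum_one]
  exact sum_comm

theorem p1_mul_x1 (θ : InfoStruct S1 S2) (s : S1) : θ.p1 s * θ.x1 s = ∑ s2, θ.P true s s2 := by
  by_cases hp : θ.p1 s = 0
  · have := θ.p1_eq s
    have := θ.marginal_nonneg true s
    have := θ.marginal_nonneg false s
    rw [hp, zero_mul]
    linarith
  · exact mul_div_cancel₀ _ hp

theorem x1_nonneg (θ : InfoStruct S1 S2) (s : S1) : 0 ≤ θ.x1 s :=
  div_nonneg (θ.marginal_nonneg true s) (θ.p1_nonneg s)

theorem x1_le_one (θ : InfoStruct S1 S2) (s : S1) : θ.x1 s ≤ 1 :=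
  div_le_one_of_le₀ (by linarith [θ.p1_eq s, θ.marginal_nonneg false s]) (θ.p1_nonneg s)

/-- A mean-preserving spread `k` of agent 1's reports to the values `g` is realized by giving
agent 1 a more informative signal. -/
theorem exists_spread (θ : InfoStruct S1 S2) (k : S1 → T → ℝ) (g : T → ℝ)
    (hk : ∀ s t, 0 ≤ k s t) (hk1 : ∀ s, ∑ t, k s t = 1) (hg0 : ∀ t, 0 ≤ g t)
    (hg1 : ∀ t, g t ≤ 1) (hkg : ∀ s, ∑ t, k s t * g t = θ.x1 s) :
    ∃ θ' : InfoStruct T S2, (∀ t, θ'.x1 t = g t ∨ θ'.x1 t = 0) ∧ (∀ s2, θ'.x2 s2 = θ.x2 s2) ∧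
      ∀ h : ℝ → ℝ → ℝ, (∀ a b a' b', |h a b - h a' b'| ≤ |a - a'| + |b - b'|) →
        θ.expect h - θ'.expect h ≤ ∑ s, θ.p1 s * ∑ t, k s t * |θ.x1 s - g t| := by
  classical
  let c : Bool → T → ℝ := fun ω t => if ω then g t else 1 - g t
  let m : Bool → S1 → ℝ := fun ω s => ∑ s2, θ.P ω s s2
  have hc (ω t) : 0 ≤ c ω t := by
    cases ω
    · simpa [c] using hg1 t
    · simpa [c] using hg0 t
  have hm (ω s) : θ.p1 s * ∑ t, k s t * c ω t = m ω s := by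
    cases ω
    · simp only [c, Bool.false_eq_true, if_false, mul_sub, mul_one, sum_sub_distrib, hk1, hkg, m]
      linarith [θ.p1_mul_x1 s, θ.p1_eq s]
    · simpa [c, hkg] using θ.p1_mul_x1 s
  let R : Bool → S1 → T → ℝ := fun ω s t =>
    if m ω s = 0 then k s t else θ.p1 s * (k s t * c ω t) / m ω s
  have hR (ω s t) : 0 ≤ R ω s t := by
    simp only [R]
    split_ifs
    · exact hk s t
    · exact div_nonneg (mul_nonneg (θ.p1_nonneg s) (mul_nonneg (hk s t) (hc ω t)))
        (θ.marginal_nonneg ω s)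
  have hR1 (ω s) : ∑ t, R ω s t = 1 := by
    simp only [R]
    split_ifs with h0
    · exact hk1 s
    · rw [← sum_div, ← mul_sum, hm, div_self h0]
  have hRm (ω s t) : R ω s t * m ω s = θ.p1 s * (k s t * c ω t) := by
    simp only [R]
    split_ifs with h0
    · have hz := hm ω s
      rw [h0, mul_sum, sum_eq_zero_iff_of_nonneg fun t _ =>
        mul_nonneg (θ.p1_nonneg s) (mul_nonneg (hk s t) (hc ω t))] at hz
      rw [h0, mul_zero, hz t (mem_univ t)]
    · exact div_mul_cancel₀ _ h0
  have hp1 (t) : (θ.mapSignal R hR hR1).p1 t = ∑ s, θ.p1 s * k s t := by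
    rw [p1_eq, marginal_mapSignal, marginal_mapSignal, ← sum_add_distrib]
    refine sum_congr rfl fun s _ => ?_
    change R true s t * m true s + R false s t * m false s = _
    rw [hRm, hRm]
    simp only [c, if_true, Bool.false_eq_true, if_false]
    ring
  have hx1 (t) : (θ.mapSignal R hR hR1).x1 t = (∑ s, θ.p1 s * k s t) * g t /
      ∑ s, θ.p1 s * k s t := by
    rw [x1, hp1, marginal_mapSignal, sum_mul]
    congr 1
    refine sum_congr rfl fun s _ => ?_
    change R true s t * m true s = _
    rw [hRm]
    simp only [c, if_true]
    ring
  refine ⟨θ.mapSignal R hR hR1, fun t => ?_, θ.x2_mapSignal R hR hR1, fun h hh => ?_⟩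
  · rw [hx1]
    by_cases h0 : ∑ s, θ.p1 s * k s t = 0
    · simp [h0]
    · exact Or.inl (mul_div_cancel_left₀ _ h0)
  · refine (θ.expect_sub_expect_mapSignal_le R hR hR1 h hh).trans (le_of_eq ?_)
    refine sum_congr rfl fun s _ => ?_
    rw [mul_sum]
    refine sum_congr rfl fun t _ => ?_
    have hw : ∑ ω, R ω s t * ∑ s2, θ.P ω s s2 = θ.p1 s * k s t := by
      change ∑ ω, R ω s t * m ω s = _
      simp only [hRm, c, Fintype.sum_bool, if_true, Bool.false_eq_true, if_false]
      ring
    rw [hw, ← mul_assoc]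
    by_cases h0 : θ.p1 s * k s t = 0
    · simp [h0]
    · have : ∑ s, θ.p1 s * k s t ≠ 0 := fun hz => h0 <|
        (sum_eq_zero_iff_of_nonneg fun s _ => mul_nonneg (θ.p1_nonneg s) (hk s t)).1 hz s
          (mem_univ s)
      rw [hx1, mul_div_cancel_left₀ _ this]

end InfoStruct

/-- The mean-preserving spread of `x ∈ [lo, hi]` to the endpoints. -/
theorem exists_endpoint_weights {lo hi x : ℝ} (h₁ : lo ≤ x) (h₂ : x ≤ hi) :
    ∃ a b : ℝ, 0 ≤ a ∧ 0 ≤ b ∧ a + b = 1 ∧ a * lo + b * hi = x ∧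
      a * |x - lo| + b * |x - hi| ≤ 2 * min (x - lo) (hi - x) := by
  obtain ⟨a, b, ha, hb, hab, hx⟩ : x ∈ segment ℝ lo hi := by
    rw [segment_eq_Icc (h₁.trans h₂)]
    exact ⟨h₁, h₂⟩
  simp only [smul_eq_mul] at hx
  refine ⟨a, b, ha, hb, hab, hx, ?_⟩
  rw [abs_of_nonneg (sub_nonneg.2 h₁), abs_of_nonpos (sub_nonpos.2 h₂)]
  have hbal : a * (x - lo) = b * (hi - x) := by linear_combination x * hab - hx
  rcases min_choice (x - lo) (hi - x) with h | h <;> rw [h]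
  · nlinarith
  · nlinarith

theorem exists_grid_le {N : ℕ} (hN : 1 ≤ N) {x : ℝ} (h₀ : 0 ≤ x) (h₁ : x ≤ 1) :
    ∃ r, inGrid N r ∧ r ≤ x ∧ x - r ≤ 1 / N := by
  have hN' : (0 : ℝ) < N := by exact_mod_cast hN
  refine ⟨_, ⟨⌊x * N⌋₊, ?_, rfl⟩, ?_, ?_⟩
  · exact Nat.floor_le_of_le (by nlinarith)
  · exact (div_le_iff₀ hN').2 (Nat.floor_le (by positivity))
  · rw [sub_le_iff_le_add, ← add_div, le_div_iff₀ hN']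
    linarith [Nat.lt_floor_add_one (x * N)]

theorem exists_le_grid {N : ℕ} (hN : 1 ≤ N) {x : ℝ} (h₀ : 0 ≤ x) (h₁ : x ≤ 1) :
    ∃ r, inGrid N r ∧ x ≤ r ∧ r - x ≤ 1 / N := by
  have hN' : (0 : ℝ) < N := by exact_mod_cast hN
  refine ⟨_, ⟨⌈x * N⌉₊, ?_, rfl⟩, ?_, ?_⟩
  · exact Nat.ceil_le.2 (by nlinarith)
  · exact (le_div_iff₀ hN').2 (Nat.le_ceil _)
  · rw [sub_le_iff_le_add, ← sub_le_iff_le_add', div_eq_mul_inv, div_eq_mul_inv,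
      one_mul, sub_le_iff_le_add, ← div_eq_mul_inv, div_le_iff₀ hN', add_mul,
      inv_mul_cancel₀ hN'.ne']
    linarith [Nat.ceil_lt_add_one (show 0 ≤ x * N by positivity)]

theorem inGrid.nonneg {N : ℕ} {r : ℝ} (h : inGrid N r) : 0 ≤ r := by
  obtain ⟨k, -, rfl⟩ := h
  positivity

theorem inGrid.le_one {N : ℕ} {r : ℝ} (h : inGrid N r) : r ≤ 1 := by
  obtain ⟨k, hk, rfl⟩ := h
  exact div_le_one_of_le₀ (by exact_mod_cast hk) (by positivity)

theorem inGrid_zero (N : ℕ) : inGrid N 0 := ⟨0, by simp, by simp⟩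

/-- Agent 1's reports can be spread to the grid at cost `2 / N`, leaving agent 2's reports
unchanged. -/
theorem exists_x1_inGrid {S2 : Type} [Fintype S2] {N : ℕ} (hN : 1 ≤ N)
    (θ : InfoStruct Bool S2) :
    ∃ θ' : InfoStruct Bool S2, (∀ t, inGrid N (θ'.x1 t)) ∧ (∀ s2, θ'.x2 s2 = θ.x2 s2) ∧
      ∀ h : ℝ → ℝ → ℝ, (∀ a b a' b', |h a b - h a' b'| ≤ |a - a'| + |b - b'|) →
        θ.expect h - θ'.expect h ≤ 2 / N := by
  obtain ⟨lo, hi, hlo, hhi, hx⟩ : ∃ lo hi, inGrid N lo ∧ inGrid N hi ∧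
      ∀ s, lo ≤ θ.x1 s ∧ θ.x1 s ≤ hi ∧ min (θ.x1 s - lo) (hi - θ.x1 s) ≤ 1 / N := by
    have key (s s' : Bool) (hle : θ.x1 s ≤ θ.x1 s') : ∃ lo hi, inGrid N lo ∧ inGrid N hi ∧
        (lo ≤ θ.x1 s ∧ θ.x1 s ≤ hi ∧ min (θ.x1 s - lo) (hi - θ.x1 s) ≤ 1 / N) ∧
        (lo ≤ θ.x1 s' ∧ θ.x1 s' ≤ hi ∧ min (θ.x1 s' - lo) (hi - θ.x1 s') ≤ 1 / N) := by
      obtain ⟨lo, hlo, hlo₁, hlo₂⟩ := exists_grid_le hN (θ.x1_nonneg s) (θ.x1_le_one s)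
      obtain ⟨hi, hhi, hhi₁, hhi₂⟩ := exists_le_grid hN (θ.x1_nonneg s') (θ.x1_le_one s')
      exact ⟨lo, hi, hlo, hhi, ⟨hlo₁, hle.trans hhi₁, min_le_of_left_le hlo₂⟩,
        ⟨hlo₁.trans hle, hhi₁, min_le_of_right_le hhi₂⟩⟩
    rcases le_total (θ.x1 false) (θ.x1 true) with hle | hle
    · obtain ⟨lo, hi, hlo, hhi, h₁, h₂⟩ := key _ _ hle
      exact ⟨lo, hi, hlo, hhi, Bool.forall_bool.2 ⟨h₁, h₂⟩⟩
    · obtain ⟨lo, hi, hlo, hhi, h₁, h₂⟩ := key _ _ hle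
      exact ⟨lo, hi, hlo, hhi, Bool.forall_bool.2 ⟨h₂, h₁⟩⟩
  choose a b ha hb hab hmean hcost using fun s => exists_endpoint_weights (hx s).1 (hx s).2.1
  have hg (t : Bool) : inGrid N (if t then hi else lo) := by
    split_ifs
    exacts [hhi, hlo]
  obtain ⟨θ', hθ₁, hθ₂, hθ⟩ := θ.exists_spread (fun s t => if t then b s else a s)
    (fun t : Bool => if t then hi else lo)
    (fun s t => by split_ifs; exacts [hb s, ha s])
    (fun s => by simpa [add_comm] using hab s)
    (fun t => (hg t).nonneg) (fun t => (hg t).le_one)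
    (fun s => by simpa [add_comm] using hmean s)
  refine ⟨θ', fun t => ?_, hθ₂, fun h hh => (hθ h hh).trans ?_⟩
  · rcases hθ₁ t with h | h <;> rw [h]
    exacts [hg t, inGrid_zero N]
  · calc _ ≤ ∑ s, θ.p1 s * (2 / N) := by
          refine sum_le_sum fun s _ => mul_le_mul_of_nonneg_left ?_ (θ.p1_nonneg s)
          have h₁ := hcost s
          have h₂ := (hx s).2.2
          rw [show (2 : ℝ) / N = 2 * (1 / N) by ring]
          simp only [Fintype.sum_bool, if_true, Bool.false_eq_true, if_false]
          linarith
      _ = 2 / N := by rw [← sum_mul, θ.sum_p1, one_mul]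

/-- `Θ̄_N` is an `(8/√N + 4/N, d_EM)`-covering of `Θ̄`: for every `N ≥ 1`,
every binary-signal conditionally independent information structure is within earth mover's
distance `8/√N + 4/N` (of report distributions) of one whose reports lie in the grid
`[1/N]`. -/
theorem dEM_covering_gridN (N : ℕ) (hN : 1 ≤ N) (θ : InfoStruct Bool Bool) :
    ∃ θ' : InfoStruct Bool Bool, reportsInGrid N θ' ∧
      dEM θ θ' ≤ 8 / Real.sqrt (N : ℝ) + 4 / (N : ℝ) := by
  obtain ⟨θ₁, hgrid₁, -, hcost₁⟩ := exists_x1_inGrid hN θ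
  obtain ⟨θ₂, hgrid₂, hx2, hcost₂⟩ := exists_x1_inGrid hN θ₁.swap
  have hswap (s : Bool) : θ₂.swap.x1 s = θ₁.x1 s := hx2 s
  refine ⟨θ₂.swap, ⟨fun s => hswap s ▸ hgrid₁ s, hgrid₂⟩, ?_⟩
  refine Real.sSup_le ?_ (by positivity)
  rintro r ⟨h, hh, rfl⟩
  have h₁ := hcost₁ h hh
  have h₂ := hcost₂ (fun a b => h b a) fun a b a' b' => by
    simpa only [add_comm] using hh b a b' a'
  rw [θ₁.expect_swap h] at h₂
  have h₃ : θ₂.swap.expect h = θ₂.expect fun a b => h b a :=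
    θ₂.expect_swap fun a b => h b a
  have h₄ : 0 ≤ 8 / Real.sqrt (N : ℝ) := by positivity
  rw [h₃]
  linarith [show (4 : ℝ) / N = 2 / N + 2 / N by ring]
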